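/- Let G = H ∗_A K be an amalgamated free product with [H : A] ≥ 3 and [K : A] ≥ 2, and let η : Σ → G be any map from a finite set Σ whose image generates G as a monoid. Then the set of words over Σ representing elliptic elements of G is strongly negligible; equivalently, the set of words representing hyperbolic elements is strongly generic. -/

import Mathlib

universe u

open Monoid

/-- The number of words of length `n` over `α` lying in `L`. -/
noncomputable def wordCount {α : Type*} (L : Set (List α)) (n : ℕ) : ℕ :=
  Nat.card {w : List α // w ∈ L ∧ w.length = n}

/-- A set of words over a finite alphabet is strongly negligible: the number of its words of
length `n` is at most `C·ρⁿ·|Σ|ⁿ` for some constants `C > 0` and `0 < ρ < 1`. -/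
def StronglyNegligible {α : Type*} [Fintype α] (L : Set (List α)) : Prop :=
  ∃ C ρ : ℝ, 0 < C ∧ 0 < ρ ∧ ρ < 1 ∧ ∀ n : ℕ,
    (wordCount L n : ℝ) ≤ C * ρ ^ n * (Fintype.card α : ℝ) ^ n

/-- A set of words is strongly generic if its complement is strongly negligible. -/
def StronglyGeneric {α : Type*} [Fintype α] (L : Set (List α)) : Prop :=
  StronglyNegligible Lᶜ

/-- `η : α → G` together with the involution `inv` is a symmetric generating set:
`inv` is a fixed-point-free involution, `η (inv a) = (η a)⁻¹`, and the image of `η`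
generates `G` as a group. -/
def IsSymmetricGen {α G : Type*} [Group G] (η : α → G) (inv : α → α) : Prop :=
  (∀ a, inv (inv a) = a) ∧ (∀ a, inv a ≠ a) ∧ (∀ a, η (inv a) = (η a)⁻¹) ∧
    Subgroup.closure (Set.range η) = ⊤

/-- The element of `G` represented by a word over `α`. -/
def evalWord {α G : Type*} [Monoid G] (η : α → G) (w : List α) : G :=
  (w.map η).prod

/-- The two-element family of groups used to realize `H ∗_A K` as a pushout. -/
def AmalgFam (H K : Type u) : Bool → Type u
  | true => H
  | false => K

instance amalgFamGroup {H K : Type u} [Group H] [Group K] : (b : Bool) → Group (AmalgFam H K b)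
  | true => ‹Group H›
  | false => ‹Group K›

/-- The two inclusions of the amalgamated subgroup `A`. -/
def amalgMaps {A : Type*} [Group A] {H K : Type u} [Group H] [Group K]
    (φ : A →* H) (ψ : A →* K) : (b : Bool) → A →* AmalgFam H K b
  | true => φ
  | false => ψ

/-- The amalgamated free product `H ∗_A K`, i.e. the pushout of the two inclusions of `A`. -/
abbrev AmalgProd {A : Type*} [Group A] {H K : Type u} [Group H] [Group K]
    (φ : A →* H) (ψ : A →* K) : Type _ :=
  Monoid.PushoutI (amalgMaps φ ψ)

/-- The canonical map `H →* H ∗_A K`. -/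
def amalgH {A : Type*} [Group A] {H K : Type u} [Group H] [Group K]
    (φ : A →* H) (ψ : A →* K) : H →* AmalgProd φ ψ :=
  Monoid.PushoutI.of (φ := amalgMaps φ ψ) true

/-- The canonical map `K →* H ∗_A K`. -/
def amalgK {A : Type*} [Group A] {H K : Type u} [Group H] [Group K]
    (φ : A →* H) (ψ : A →* K) : K →* AmalgProd φ ψ :=
  Monoid.PushoutI.of (φ := amalgMaps φ ψ) false

/-- An element of `G` is elliptic with respect to the set `S` if it is conjugate in `G`
to an element of `S`. -/
def IsElliptic {G : Type*} [Group G] (S : Set G) (x : G) : Prop :=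
  ∃ h ∈ S, IsConj h x

/-! ### Spectral part -/

section Spectral

variable {V : Type*}

theorem fs_summable_mul {f : V → ℝ} (hf : f.support.Finite) (g : V → ℝ) :
    Summable (fun v => f v * g v) := by
  apply summable_of_hasFiniteSupport
  apply hf.subset
  intro v hv h
  simp_all

/-- squared norm -/
noncomputable def nsq (f : V → ℝ) : ℝ := ∑' v, f v * f v

theorem nsq_nonneg (f : V → ℝ) : 0 ≤ nsq f := tsum_nonneg fun v => mul_self_nonneg _

theorem sq_le_nsq {f : V → ℝ} (hf : f.support.Finite) (v : V) : f v * f v ≤ nsq f :=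
  (fs_summable_mul hf f).le_tsum v (fun w _ => mul_self_nonneg _)

variable {G : Type*} [Group G] [MulAction G V]

theorem fs_smul {f : V → ℝ} (hf : f.support.Finite) (g : G) :
    (fun v => f (g • v)).support.Finite :=
  hf.preimage (f := fun v => g • v) ((MulAction.injective g).injOn)

theorem tsum_smul (f : V → ℝ) (g : G) : ∑' v, f (g • v) = ∑' v, f v :=
  (MulAction.toPerm g).tsum_eq f

theorem ip_le {f : V → ℝ} (hf : f.support.Finite) (g h : G) :
    ∑' v, f (g • v) * f (h • v) ≤ nsq f := by
  have h1 : ∑' v, (f (g • v) * f (g • v) * (1/2) + f (h • v) * f (h • v) * (1/2)) = nsq f := by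
    rw [Summable.tsum_add, tsum_mul_right, tsum_mul_right,
      tsum_smul (fun v => f v * f v) g, tsum_smul (fun v => f v * f v) h]
    · unfold nsq; ring
    · exact (fs_summable_mul (fs_smul hf g) _).mul_right _
    · exact (fs_summable_mul (fs_smul hf h) _).mul_right _
  rw [← h1]
  apply Summable.tsum_le_tsum
  · intro v; nlinarith [sq_nonneg (f (g • v) - f (h • v))]
  · exact fs_summable_mul (fs_smul hf g) _
  · exact ((fs_summable_mul (fs_smul hf g) _).mul_right _).add
      ((fs_summable_mul (fs_smul hf h) _).mul_right _)

open Classical in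
theorem pair_le {f : V → ℝ} (hf : f.support.Finite) (X : Set V) (s : G)
    (hs : ∀ v, v ∉ X → s • v ∈ X)
    (hX : ∑' v, (if v ∈ X then 1 else 0) * (f v * f v) ≤ nsq f / 3) :
    ∑' v, f (s • v) * f v ≤ 17 / 18 * nsq f := by
  set F : V → ℝ := fun v => (1/3) * (f v * f v) + (5/12) * ((if v ∈ X then 1 else 0) * (f v * f v))
    with hF
  have hsum1 : Summable (fun v => f v * f v) := fs_summable_mul hf f
  have hsum2 : Summable (fun v => (if v ∈ X then (1:ℝ) else 0) * (f v * f v)) := by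
    have := fs_summable_mul hf (fun v => (if v ∈ X then (1:ℝ) else 0) * f v)
    convert! this using 2
    ring
  have hFs : Summable F := (hsum1.mul_left _).add (hsum2.mul_left _)
  have hFt : ∑' v, F v ≤ 17 / 36 * nsq f := by
    rw [hF, Summable.tsum_add (hsum1.mul_left _) (hsum2.mul_left _), tsum_mul_left, tsum_mul_left]
    change 1/3 * nsq f + _ ≤ _
    linarith
  have hFs' : Summable (fun v => F (s • v)) :=
    ((MulAction.toPerm s).summable_iff (f := F)).2 hFs
  calc ∑' v, f (s • v) * f v ≤ ∑' v, (F (s • v) + F v) := by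
        apply Summable.tsum_le_tsum
        · intro v
          simp only [hF]
          by_cases hv : v ∈ X
          · by_cases hv' : s • v ∈ X
            · simp only [hv, hv', if_true]
              nlinarith [sq_nonneg (f (s • v) - f v), sq_nonneg (f (s • v)), sq_nonneg (f v)]
            · simp only [hv, hv', if_true, if_false]
              nlinarith [sq_nonneg (2 * f (s • v) - 3 * f v)]
          · simp only [hv, hs v hv, if_true, if_false]
            nlinarith [sq_nonneg (3 * f (s • v) - 2 * f v)]
        · exact fs_summable_mul (fs_smul hf s) _
        · exact hFs'.add hFs
    _ = ∑' v, F v + ∑' v, F v := by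
        rw [Summable.tsum_add hFs' hFs, tsum_smul F s]
    _ ≤ _ := by linarith

open Classical in
theorem exists_pair_le {f : V → ℝ} (hf : f.support.Finite) (X : Fin 3 → Set V) (s : Fin 3 → G)
    (hX : ∀ i j, i ≠ j → Disjoint (X i) (X j))
    (hs : ∀ i v, v ∉ X i → s i • v ∈ X i) :
    ∃ i, ∑' v, f (s i • v) * f v ≤ 17 / 18 * nsq f := by
  by_contra hcon
  push Not at hcon
  have h : ∀ i, nsq f / 3 < ∑' v, (if v ∈ X i then 1 else 0) * (f v * f v) := by
    intro i
    by_contra h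
    exact absurd (pair_le hf (X i) (s i) (hs i) (not_lt.1 h)) (not_le.2 (hcon i))
  have hsum2 : ∀ i, Summable (fun v => (if v ∈ X i then (1:ℝ) else 0) * (f v * f v)) := by
    intro i
    have := fs_summable_mul hf (fun v => (if v ∈ X i then (1:ℝ) else 0) * f v)
    convert! this using 2
    ring
  have h2 : ∑' v, ∑ i : Fin 3, ((if v ∈ X i then (1:ℝ) else 0) * (f v * f v)) ≤ nsq f := by
    apply Summable.tsum_le_tsum
    · intro v
      have d01 : v ∈ X 0 → v ∉ X 1 := fun h => Set.disjoint_left.1 (hX 0 1 (by decide)) h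
      have d02 : v ∈ X 0 → v ∉ X 2 := fun h => Set.disjoint_left.1 (hX 0 2 (by decide)) h
      have d12 : v ∈ X 1 → v ∉ X 2 := fun h => Set.disjoint_left.1 (hX 1 2 (by decide)) h
      have := mul_self_nonneg (f v)
      rw [Fin.sum_univ_three]
      by_cases h0 : v ∈ X 0 <;> by_cases h1 : v ∈ X 1 <;> by_cases h2 : v ∈ X 2 <;> simp_all
    · exact summable_sum fun i _ => hsum2 i
    · exact fs_summable_mul hf f
  rw [Summable.tsum_finsetSum (fun i _ => hsum2 i), Fin.sum_univ_three] at h2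
  linarith [h 0, h 1, h 2]

/-- transfer operator -/
def Tr {ι : Type*} [Fintype ι] (g : ι → G) (f : V → ℝ) : V → ℝ :=
  fun v => ∑ i, f ((g i)⁻¹ • v)

theorem Tr_fs {ι : Type*} [Fintype ι] (g : ι → G) {f : V → ℝ} (hf : f.support.Finite) :
    (Tr g f).support.Finite := by
  have : (⋃ i, (fun v => f ((g i)⁻¹ • v)).support).Finite :=
    Set.finite_iUnion fun i => fs_smul hf _
  apply this.subset
  intro v hv
  by_contra h
  apply hv
  simp only [Set.mem_iUnion, Function.mem_support, not_exists, not_not] at h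
  simp [Tr, h]

theorem nsq_Tr {ι : Type*} [Fintype ι] (g : ι → G) {f : V → ℝ} (hf : f.support.Finite) :
    nsq (Tr g f) = ∑ i, ∑ j, ∑' v, f ((g i)⁻¹ • v) * f ((g j)⁻¹ • v) := by
  have hs : ∀ i j, Summable (fun v => f ((g i)⁻¹ • v) * f ((g j)⁻¹ • v)) :=
    fun i j => fs_summable_mul (fs_smul hf _) _
  unfold nsq Tr
  simp_rw [Finset.sum_mul_sum]
  rw [Summable.tsum_finsetSum (fun i _ => summable_sum fun j _ => hs i j)]
  refine Finset.sum_congr rfl fun i _ => ?_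
  rw [Summable.tsum_finsetSum (fun j _ => hs i j)]

theorem nsq_Tr_le {ι : Type*} [Fintype ι] (g : ι → G) {f : V → ℝ} (hf : f.support.Finite) :
    nsq (Tr g f) ≤ (Fintype.card ι : ℝ) ^ 2 * nsq f := by
  rw [nsq_Tr g hf]
  calc _ ≤ ∑ i : ι, ∑ j : ι, nsq f :=
        Finset.sum_le_sum fun i _ => Finset.sum_le_sum fun j _ => ip_le hf _ _
    _ = _ := by simp; ring

theorem nsq_Tr_lt {ι : Type*} [Fintype ι] (g : ι → G) {f : V → ℝ} (hf : f.support.Finite)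
    (X : Fin 3 → Set V) (hX : ∀ i j, i ≠ j → Disjoint (X i) (X j)) (c : ι) (hc : g c = 1)
    (u : Fin 3 → ι) (hs : ∀ i v, v ∉ X i → g (u i) • v ∈ X i) :
    nsq (Tr g f) ≤ ((Fintype.card ι : ℝ) ^ 2 - 1 / 18) * nsq f := by
  classical
  obtain ⟨k, hk⟩ := exists_pair_le hf X (fun i => g (u i)) hX hs
  have hk' : ∑' v, f ((g c)⁻¹ • v) * f ((g (u k))⁻¹ • v) ≤ 17 / 18 * nsq f := by
    rw [← tsum_smul (fun v => f ((g c)⁻¹ • v) * f ((g (u k))⁻¹ • v)) (g (u k))]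
    simpa [hc] using hk
  rw [nsq_Tr g hf]
  have key : ∀ p : ι × ι, ∑' v, f ((g p.1)⁻¹ • v) * f ((g p.2)⁻¹ • v) ≤
      nsq f - (if p = (c, u k) then 1/18 * nsq f else 0) := by
    intro p
    split_ifs with h
    · subst h; linarith
    · simpa using ip_le hf _ _
  rw [← Fintype.sum_prod_type']
  calc _ ≤ ∑ p : ι × ι, (nsq f - (if p = (c, u k) then 1/18 * nsq f else 0)) :=
        Finset.sum_le_sum fun p _ => key p
    _ = _ := by
      rw [Finset.sum_sub_distrib]; simp; ring

/-- evaluation of a tuple -/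
def evT {α : Type*} (η : α → G) {n : ℕ} (u : Fin n → α) : G := evalWord η (List.ofFn u)

theorem Tr_iter {α : Type*} [Fintype α] (η : α → G) (f : V → ℝ) (n : ℕ) :
    (Tr η)^[n] f = Tr (fun u : Fin n → α => evT η u) f := by
  induction n with
  | zero => ext v; simp [Tr, evT, evalWord]
  | succ n ih =>
    rw [Function.iterate_succ_apply', ih]
    ext v
    simp only [Tr]
    rw [← (Fin.consEquiv (fun _ : Fin (n+1) => α)).sum_comp, Fintype.sum_prod_type]
    refine Finset.sum_congr rfl fun a _ => Finset.sum_congr rfl fun u _ => ?_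
    simp [evT, evalWord, Fin.consEquiv, mul_smul]

theorem Tr_iter_fs {α : Type*} [Fintype α] (η : α → G) {f : V → ℝ} (hf : f.support.Finite)
    (n : ℕ) : ((Tr η)^[n] f).support.Finite := by
  rw [Tr_iter]; exact Tr_fs _ hf

theorem nsq_bound {α : Type*} [Fintype α] [Nonempty α] (η : α → G) {f : V → ℝ}
    (hf : f.support.Finite) (X : Fin 3 → Set V) (hX : ∀ i j, i ≠ j → Disjoint (X i) (X j))
    (L : ℕ) (hL : 0 < L) (c : Fin L → α) (hc : evT η c = 1)
    (u : Fin 3 → Fin L → α) (hs : ∀ i v, v ∉ X i → evT η (u i) • v ∈ X i) :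
    ∃ C ρ : ℝ, 0 < C ∧ 0 < ρ ∧ ρ < 1 ∧ ∀ n : ℕ,
      nsq ((Tr η)^[n] f) ≤ (C * ρ ^ n * (Fintype.card α : ℝ) ^ n) ^ 2 := by
  set M : ℝ := (Fintype.card α : ℝ) with hM
  have hM1 : 1 ≤ M := by
    rw [hM]; exact_mod_cast Fintype.card_pos
  have hML : 1 ≤ M ^ L := one_le_pow₀ hM1
  set ρ0 : ℝ := ((M ^ L) ^ 2 - 1/18) / (M ^ L) ^ 2 with hρ0
  have hML2 : 1 ≤ (M ^ L) ^ 2 := one_le_pow₀ hML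
  have hρpos : 0 < ρ0 := by rw [hρ0]; apply div_pos <;> linarith
  have hρ1 : ρ0 < 1 := by rw [hρ0, div_lt_one (by linarith)]; linarith
  have h2L : (2 * L) ≠ 0 := by omega
  set ρ : ℝ := ρ0 ^ (((2 * L : ℕ) : ℝ)⁻¹) with hρ
  have hr : ρ ^ (2 * L) = ρ0 := Real.rpow_inv_natCast_pow hρpos.le h2L
  have hrpos : 0 < ρ := Real.rpow_pos_of_pos hρpos _
  have hr1 : ρ < 1 := by
    by_contra h
    have := one_le_pow₀ (not_lt.1 h) (n := 2 * L)
    linarith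
  have hstep : ∀ n, nsq ((Tr η)^[n + L] f) ≤ (ρ ^ L * M ^ L) ^ 2 * nsq ((Tr η)^[n] f) := by
    intro n
    rw [add_comm, Function.iterate_add_apply, Tr_iter]
    refine (nsq_Tr_lt _ (Tr_iter_fs η hf n) X hX c hc u hs).trans (le_of_eq ?_)
    have : (ρ ^ L * M ^ L) ^ 2 = (M ^ L) ^ 2 - 1 / 18 := by
      rw [mul_pow, ← pow_mul, mul_comm L 2, hr, hρ0]
      field_simp
    rw [this]
    simp [hM]
  have hsmall : ∀ n, nsq ((Tr η)^[n] f) ≤ (M ^ n) ^ 2 * nsq f := by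
    intro n
    rw [Tr_iter]
    refine (nsq_Tr_le _ hf).trans (le_of_eq ?_)
    simp [hM]
  set D : ℝ := nsq f + 1 with hD
  have hf0 := nsq_nonneg f
  have hrLpos : 0 < ρ ^ L := pow_pos hrpos L
  refine ⟨D / ρ ^ L, ρ, by positivity, hrpos, hr1, fun n => ?_⟩
  induction n using Nat.strong_induction_on with
  | _ n ih =>
    by_cases hn : n < L
    · refine (hsmall n).trans ?_
      have h1 : ρ ^ L ≤ ρ ^ n := pow_le_pow_of_le_one hrpos.le hr1.le hn.le
      have h2 : D ≤ D / ρ ^ L * ρ ^ n := by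
        rw [div_mul_eq_mul_div, le_div_iff₀ hrLpos]
        gcongr
      have h3 : nsq f ≤ (D / ρ ^ L * ρ ^ n) ^ 2 := by nlinarith
      rw [mul_pow, mul_comm]
      gcongr
    · obtain ⟨m, rfl⟩ := Nat.exists_eq_add_of_le (not_lt.1 hn)
      rw [add_comm L m]
      refine (hstep m).trans ?_
      calc _ ≤ (ρ ^ L * M ^ L) ^ 2 * (D / ρ ^ L * ρ ^ m * M ^ m) ^ 2 := by
            gcongr
            exact ih m (by omega)
        _ = _ := by ring

theorem evalWord_append {α : Type*} (η : α → G) (w w' : List α) :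
    evalWord η (w ++ w') = evalWord η w * evalWord η w' := by simp [evalWord]

theorem exists_word {α : Type*} (η : α → G) (hgen : Submonoid.closure (Set.range η) = ⊤) (g : G) :
    ∃ w : List α, evalWord η w = g := by
  have : g ∈ Submonoid.closure (Set.range η) := by rw [hgen]; trivial
  induction this using Submonoid.closure_induction with
  | mem x hx => obtain ⟨a, rfl⟩ := hx; exact ⟨[a], by simp [evalWord]⟩
  | one => exact ⟨[], by simp [evalWord]⟩
  | mul x y _ _ hx hy =>
    obtain ⟨w, rfl⟩ := hx
    obtain ⟨w', rfl⟩ := hy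
    exact ⟨w ++ w', evalWord_append _ _ _⟩

theorem exists_pow_tuple {α : Type*} (η : α → G) (w : List α) (j : ℕ) :
    ∃ u : Fin (j * w.length) → α, evT η u = evalWord η w ^ j := by
  have : ∃ w' : List α, w'.length = j * w.length ∧ evalWord η w' = evalWord η w ^ j := by
    induction j with
    | zero => exact ⟨[], by simp, by simp [evalWord]⟩
    | succ j ih =>
      obtain ⟨w', h1, h2⟩ := ih
      exact ⟨w' ++ w, by simp [h1]; ring, by rw [evalWord_append, h2, pow_succ]⟩
  obtain ⟨w', h1, h2⟩ := this
  rw [← h1]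
  exact ⟨w'.get, by simp [evT, h2]⟩

/-- Main spectral bound: number of words fixing a point. -/
theorem spectral {α : Type*} [Fintype α] [Nonempty α] (η : α → G)
    (hgen : Submonoid.closure (Set.range η) = ⊤)
    (X : Fin 3 → Set V) (hX : ∀ i j, i ≠ j → Disjoint (X i) (X j)) (s : Fin 3 → G)
    (hs : ∀ i, ∀ j, 1 ≤ j → ∀ v, v ∉ X i → s i ^ j • v ∈ X i) (q : V) :
    ∃ C ρ : ℝ, 0 < C ∧ 0 < ρ ∧ ρ < 1 ∧ ∀ n : ℕ,
      (Nat.card {u : Fin n → α // evT η u • q = q} : ℝ) ≤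
        C * ρ ^ n * (Fintype.card α : ℝ) ^ n := by
  classical
  obtain ⟨c, hcl, hc⟩ : ∃ c : List α, 0 < c.length ∧ evalWord η c = 1 := by
    obtain ⟨a⟩ := ‹Nonempty α›
    obtain ⟨w, hw⟩ := exists_word η hgen (η a)⁻¹
    exact ⟨a :: w, by simp, by
      have : evalWord η (a :: w) = η a * evalWord η w := by simp [evalWord]
      rw [this, hw]; simp⟩
  have hw : ∀ i, ∃ w : List α, 0 < w.length ∧ evalWord η w = s i := by
    intro i
    obtain ⟨w, hw⟩ := exists_word η hgen (s i)
    exact ⟨c ++ w, by simp; omega, by rw [evalWord_append, hc, hw, one_mul]⟩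
  choose w hwl hw using hw
  set L := c.length * ∏ i, (w i).length with hL
  have hLpos : 0 < L := Nat.mul_pos hcl (Finset.prod_pos fun i _ => hwl i)
  have hdc : c.length ∣ L := ⟨_, hL⟩
  have hdw : ∀ i, (w i).length ∣ L := fun i =>
    (Finset.dvd_prod_of_mem (fun i => (w i).length) (Finset.mem_univ i)).mul_left _
  have hcc : ∃ u : Fin L → α, evT η u = 1 := by
    obtain ⟨j, hj⟩ := hdc
    rw [hj, mul_comm]
    obtain ⟨u, hu⟩ := exists_pow_tuple η c j
    exact ⟨u, by rw [hu, hc, one_pow]⟩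
  have hww : ∀ i, ∃ u : Fin L → α, ∃ j, 1 ≤ j ∧ evT η u = s i ^ j := by
    intro i
    obtain ⟨j, hj⟩ := hdw i
    have hj1 : 1 ≤ j := by
      rcases Nat.eq_zero_or_pos j with h | h
      · subst h; omega
      · exact h
    rw [hj, mul_comm]
    obtain ⟨u, hu⟩ := exists_pow_tuple η (w i) j
    exact ⟨u, j, hj1, by rw [hu, hw]⟩
  obtain ⟨cc, hcc⟩ := hcc
  choose u j hj1 hu using hww
  set f : V → ℝ := fun v => if v = q then 1 else 0 with hfdef
  have hf : f.support.Finite := by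
    apply (Set.finite_singleton q).subset
    intro v hv
    by_contra h
    apply hv
    simp only [Set.mem_singleton_iff] at h
    simp [hfdef, h]
  obtain ⟨C, ρ, hC, hρ, hρ1, hb⟩ := nsq_bound η hf X hX L hLpos cc hcc u
    (fun i v hv => by rw [hu]; exact hs i _ (hj1 i) v hv)
  refine ⟨C, ρ, hC, hρ, hρ1, fun n => ?_⟩
  have h1 : (Nat.card {u : Fin n → α // evT η u • q = q} : ℝ) = (Tr η)^[n] f q := by
    rw [Tr_iter]
    simp only [Tr, hfdef, inv_smul_eq_iff]
    rw [Nat.card_eq_fintype_card, Fintype.card_subtype, Finset.sum_boole]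
    simp only [eq_comm]
  rw [h1]
  have h2 := (sq_le_nsq (Tr_iter_fs η hf n) q).trans (hb n)
  rw [← sq] at h2
  exact (abs_le_of_sq_le_sq' h2 (by positivity)).2

/-- Ping-pong criterion. -/
theorem pingpong {α : Type*} [Fintype α] [Nonempty α] (η : α → G)
    (hgen : Submonoid.closure (Set.range η) = ⊤)
    (P : Set V) (k : G) (a : Fin 3 → G)
    (ha : ∀ i j, i ≠ j → ∀ v, v ∉ P → (a i)⁻¹ • a j • v ∈ P) (ha0 : a 0 = 1)
    (hk : ∀ v ∈ P, k • v ∉ P) (q : V) :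
    ∃ C ρ : ℝ, 0 < C ∧ 0 < ρ ∧ ρ < 1 ∧ ∀ n : ℕ,
      (Nat.card {u : Fin n → α // evT η u • q = q} : ℝ) ≤
        C * ρ ^ n * (Fintype.card α : ℝ) ^ n := by
  -- t = b k a⁻¹ with a = a 1, b = a 2
  set t : G := a 2 * k * (a 1)⁻¹ with ht
  have h1 : ∀ v, v ∉ P → (a 1)⁻¹ • v ∈ P := by
    intro v hv
    simpa [ha0] using ha 1 0 (by decide) v hv
  have h2 : ∀ v, v ∉ P → a 2 • v ∈ P := by
    intro v hv
    simpa [ha0] using ha 0 2 (by decide) v hv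
  have ht1 : ∀ v, v ∉ P → ∃ x, x ∉ P ∧ t • v = a 2 • x := by
    intro v hv
    exact ⟨k • (a 1)⁻¹ • v, hk _ (h1 v hv), by simp [ht, mul_smul]⟩
  have ht2 : ∀ v, v ∉ P → ∃ x, x ∉ P ∧ t • a 2 • v = a 2 • x := by
    intro v hv
    exact ⟨k • (a 1)⁻¹ • a 2 • v, hk _ (ha 1 2 (by decide) v hv), by simp [ht, mul_smul]⟩
  have htj : ∀ j, 1 ≤ j → ∀ v, v ∉ P → ∃ x, x ∉ P ∧ t ^ j • v = a 2 • x := by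
    intro j hj v hv
    induction j, hj using Nat.le_induction with
    | base => simpa using ht1 v hv
    | succ j hj ih =>
      obtain ⟨x, hx, hx'⟩ := ih
      obtain ⟨y, hy, hy'⟩ := ht2 x hx
      exact ⟨y, hy, by rw [pow_succ', mul_smul, hx', hy']⟩
  refine spectral η hgen (fun i => {v | (a i * k)⁻¹ • v ∈ P}) ?_
    (fun i => (a i * k) * t * (a i * k)⁻¹) ?_ q
  · intro i j hij
    rw [Set.disjoint_left]
    intro v hv hv'
    simp only [Set.mem_ofPred_eq] at hv hv'
    have e1 := hk _ hv
    have e2 := hk _ hv'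
    simp only [mul_inv_rev, mul_smul, smul_inv_smul] at e1 e2
    have := ha i j hij _ e2
    simp only [smul_inv_smul] at this
    exact e1 this
  · intro i j hj v hv
    simp only [Set.mem_ofPred_eq] at hv ⊢
    obtain ⟨x, hx, hx'⟩ := htj j hj _ hv
    rw [conj_pow, mul_smul, mul_smul, inv_smul_smul, hx']
    exact h2 x hx

end Spectral

/-! ### Normal forms -/

section Normal

open Monoid.PushoutI Monoid.PushoutI.NormalWord Monoid.CoprodI

variable {ι : Type*} {F : ι → Type*} {B : Type*} [∀ i, Group (F i)] [Group B]
  {θ : ∀ i, B →* F i} [DecidableEq ι] [∀ i, DecidableEq (F i)]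

/-- elements whose normal form starts in factor `i` -/
def Start (d : Transversal θ) (i : ι) : Set (PushoutI θ) :=
  {g | (g • (NormalWord.empty : NormalWord d)).fstIdx = some i}

theorem cons_fstIdx {d : Transversal θ} {i : ι} (g : F i) (w : NormalWord d)
    (h : w.fstIdx ≠ some i) (hg : g ∉ (θ i).range) :
    (NormalWord.cons g w h hg).fstIdx = some i := by
  simp [Word.fstIdx, NormalWord.cons, Word.cons]

theorem of_smul_fstIdx {d : Transversal θ} {i : ι} (g : F i) (w : NormalWord d)
    (h : w.fstIdx ≠ some i) (hg : g ∉ (θ i).range) :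
    ((of i g : PushoutI θ) • w).fstIdx = some i := by
  rw [← cons_eq_smul g w h hg, cons_fstIdx]

theorem base_smul_fstIdx {d : Transversal θ} (b : B) (w : NormalWord d) :
    ((base θ b) • w).fstIdx = w.fstIdx := by
  rw [base_smul_def]

theorem one_notMem_Start (d : Transversal θ) (i : ι) : (1 : PushoutI θ) ∉ Start d i := by
  intro h
  simp [Start, Word.fstIdx, Word.empty] at h

theorem mul_mem_Start (d : Transversal θ) {i : ι} (g : F i) (hg : g ∉ (θ i).range)
    {x : PushoutI θ} (hx : x ∉ Start d i) : of i g * x ∈ Start d i := by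
  simp only [Start, Set.mem_ofPred_eq, mul_smul] at hx ⊢
  exact of_smul_fstIdx g _ hx hg

theorem Start_disj (d : Transversal θ) {i j : ι} (hij : i ≠ j) {x : PushoutI θ}
    (hx : x ∈ Start d i) : x ∉ Start d j := by
  simp only [Start, Set.mem_ofPred_eq] at hx ⊢
  rw [hx]; simpa using hij

theorem of_smul_empty_fstIdx (d : Transversal θ) {i j : ι} (hij : i ≠ j) (y : F j) :
    ((of j y : PushoutI θ) • (NormalWord.empty : NormalWord d)).fstIdx ≠ some i := by
  by_cases hy : y ∈ (θ j).range
  · obtain ⟨b, rfl⟩ := hy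
    rw [of_apply_eq_base, base_smul_fstIdx]
    simp [Word.fstIdx, Word.empty]
  · rw [of_smul_fstIdx y _ (by simp [Word.fstIdx, Word.empty]) hy]
    simpa using hij.symm

theorem right_mul_fstIdx {d : Transversal θ} {j : ι} (y : F j) (w : NormalWord d) :
    ∀ i, i ≠ j → (((w.prod * of j y) • (NormalWord.empty : NormalWord d)).fstIdx = some i ↔
      w.fstIdx = some i) := by
  induction w using NormalWord.consRecOn with
  | empty =>
    intro i hij
    have := of_smul_empty_fstIdx d hij y
    simp only [prod_empty, one_mul, this, false_iff]
    simp [Word.fstIdx, Word.empty]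
  | base b w _ ih =>
    intro i hij
    rw [base_smul_fstIdx, prod_smul, mul_assoc, mul_smul, base_smul_fstIdx, ih i hij]
  | cons i0 g w hmw hgn hgr hw1 ih =>
    intro i hij
    rw [prod_cons, mul_assoc, mul_smul, cons_fstIdx]
    by_cases hr : ((w.prod * of j y) • (NormalWord.empty : NormalWord d)).fstIdx = some i0
    · have hi0 : i0 = j := by
        by_contra h
        exact hmw ((ih i0 h).1 hr)
      subst hi0
      have hnone : w.toList = [] := by
        cases hl : w.toList with
        | nil => rfl
        | cons p l =>
          exfalso
          have hf : w.fstIdx = some p.1 := by simp [Word.fstIdx, hl]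
          have hne : p.1 ≠ i0 := by
            intro h; apply hmw; rw [hf, h]
          have := (ih p.1 hne).2 hf
          rw [hr] at this
          exact hne (Option.some.inj this).symm
      have hwe : w = NormalWord.empty := by
        apply NormalWord.ext
        · rw [hw1]; rfl
        · rw [hnone]; rfl
      subst hwe
      rw [← mul_smul, prod_empty, one_mul, ← map_mul]
      have h1 := of_smul_empty_fstIdx d hij (g * y)
      simp only [h1, false_iff]
      simpa using hij.symm
    · rw [of_smul_fstIdx g _ hr hgr]

theorem Start_right_mul (d : Transversal θ) {i j : ι} (hij : i ≠ j) (y : F j) (x : PushoutI θ) :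
    x * of j y ∈ Start d i ↔ x ∈ Start d i := by
  have := right_mul_fstIdx y (x • (NormalWord.empty : NormalWord d)) i hij
  rw [prod_smul, prod_empty, mul_one] at this
  exact this

/-- normal form length -/
noncomputable def nlen (d : Transversal θ) (g : PushoutI θ) : ℕ :=
  (g • (NormalWord.empty : NormalWord d)).toList.length

theorem base_smul_toList {d : Transversal θ} (b : B) (w : NormalWord d) :
    ((base θ b) • w).toList = w.toList := by
  rw [base_smul_def]

theorem cons_length {d : Transversal θ} {i : ι} (g : F i) (w : NormalWord d)
    (h : w.fstIdx ≠ some i) (hg : g ∉ (θ i).range) :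
    (NormalWord.cons g w h hg).toList.length = w.toList.length + 1 := by
  simp [NormalWord.cons, Word.cons]

theorem of_smul_length_aux {d : Transversal θ} {i : ι} (g : F i) (w : NormalWord d)
    (h : w.fstIdx ≠ some i) :
    ((of i g : PushoutI θ) • w).toList.length ≤ w.toList.length + 1 := by
  by_cases hg : g ∈ (θ i).range
  · obtain ⟨b, rfl⟩ := hg
    rw [of_apply_eq_base, base_smul_toList]; omega
  · rw [← cons_eq_smul g w h hg, cons_length]

theorem of_smul_length {d : Transversal θ} {i : ι} (w : NormalWord d) :
    ∀ g : F i, ((of i g : PushoutI θ) • w).toList.length ≤ w.toList.length + 1 := by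
  induction w using NormalWord.consRecOn with
  | empty => intro g; exact of_smul_length_aux g _ (by simp [Word.fstIdx, Word.empty])
  | base b w _ ih =>
    intro g
    rw [base_smul_toList, ← of_apply_eq_base θ i, ← mul_smul, ← map_mul]
    exact ih _
  | cons i0 g0 w hmw hgn hgr hw1 ih =>
    intro g
    by_cases h : i0 = i
    · subst h
      rw [cons_length]
      rw [cons_eq_smul, ← mul_smul, ← map_mul]
      exact (of_smul_length_aux _ w hmw).trans (by omega)
    · apply of_smul_length_aux
      rw [cons_fstIdx]
      simpa using h

/-- product of a list of syllables -/
def sprod (θ : ∀ i, B →* F i) (l : List (Σ i, F i)) : PushoutI θ :=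
  (l.map fun p => (of p.1 p.2 : PushoutI θ)).prod

theorem sprod_append (l l' : List (Σ i, F i)) : sprod θ (l ++ l') = sprod θ l * sprod θ l' := by
  simp [sprod]

theorem sprod_cons (p : Σ i, F i) (l : List (Σ i, F i)) :
    sprod θ (p :: l) = of p.1 p.2 * sprod θ l := by
  simp [sprod]

theorem nlen_sprod_le (d : Transversal θ) (l : List (Σ i, F i)) :
    nlen d (sprod θ l) ≤ l.length := by
  induction l with
  | nil => simp [nlen, sprod, Word.empty]
  | cons p l ih =>
    rw [sprod_cons, nlen, mul_smul]
    refine (of_smul_length _ _).trans ?_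
    simpa [nlen] using ih

theorem exists_sprod [Nonempty ι] (g : PushoutI θ) : ∃ l, sprod θ l = g := by
  induction g using PushoutI.induction_on with
  | of i g => exact ⟨[⟨i, g⟩], by simp [sprod]⟩
  | base h =>
    obtain ⟨i⟩ := ‹Nonempty ι›
    exact ⟨[⟨i, θ i h⟩], by simp [sprod, of_apply_eq_base]⟩
  | mul x y hx hy =>
    obtain ⟨l, rfl⟩ := hx
    obtain ⟨l', rfl⟩ := hy
    exact ⟨l ++ l', sprod_append _ _⟩

theorem nlen_reduced (d : Transversal θ) (l : List (Σ i, F i))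
    (hA : ∀ p ∈ l, p.2 ∉ (θ p.1).range) (hch : l.IsChain (fun p q => p.1 ≠ q.1)) :
    nlen d (sprod θ l) = l.length := by
  let w : Word F := ⟨l, fun p hp h => hA p hp (by rw [h]; exact one_mem _), hch⟩
  have hw : Reduced θ w := hA
  obtain ⟨w', h1, h2⟩ := hw.exists_normalWord_prod_eq d
  have h3 : ofCoprodI (φ := θ) w.prod = sprod θ l := by
    simp [Word.prod, sprod, w, map_list_prod, Function.comp_def]
  rw [← h3, ← h1, nlen, prod_smul_empty]
  have := congrArg List.length h2
  simpa [w] using this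

/-- two syllables can be merged -/
def Mergeable (θ : ∀ i, B →* F i) (a b : Σ i, F i) : Prop :=
  a.1 = b.1 ∨ a.2 ∈ (θ a.1).range ∨ b.2 ∈ (θ b.1).range

theorem Mergeable.exists {a b : Σ i, F i} (h : Mergeable θ a b) :
    ∃ c : Σ i, F i, (of c.1 c.2 : PushoutI θ) = of a.1 a.2 * of b.1 b.2 := by
  obtain ⟨i, a⟩ := a
  obtain ⟨j, b⟩ := b
  rcases h with h | h | h
  · dsimp at h; subst h
    exact ⟨⟨i, a * b⟩, by simp⟩
  · obtain ⟨x, hx⟩ := h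
    dsimp at hx
    refine ⟨⟨j, θ j x * b⟩, ?_⟩
    simp only [map_mul, of_apply_eq_base, ← hx]
  · obtain ⟨x, hx⟩ := h
    dsimp at hx
    refine ⟨⟨i, a * θ i x⟩, ?_⟩
    simp only [map_mul, of_apply_eq_base, ← hx]

/-- The list `l` repeated `n` times. -/
def rep {α : Type*} (l : List α) : ℕ → List α
  | 0 => []
  | n + 1 => l ++ rep l n

theorem sprod_rep (l : List (Σ i, F i)) (n : ℕ) : sprod θ (rep l n) = sprod θ l ^ n := by
  induction n with
  | zero => simp [rep, sprod]
  | succ n ih => rw [rep, sprod_append, ih, pow_succ']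

theorem rep_length {α : Type*} (l : List α) (n : ℕ) : (rep l n).length = n * l.length := by
  induction n with
  | zero => simp [rep]
  | succ n ih => rw [rep, List.length_append, ih]; ring

theorem mem_rep {α : Type*} {l : List α} {n : ℕ} {p : α} (h : p ∈ rep l n) : p ∈ l := by
  induction n with
  | zero => simp [rep] at h
  | succ n ih =>
    rw [rep, List.mem_append] at h
    exact h.elim id ih

theorem rep_head {α : Type*} {l : List α} {n : ℕ} {p : α} (h : p ∈ (rep l n).head?) :
    p ∈ l.head? := by
  cases n with
  | zero => simp [rep] at h
  | succ n =>
    cases l with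
    | nil => 
      exfalso
      have h2 := List.mem_of_mem_head? h
      have := mem_rep h2
      simp at this
    | cons a l => simpa [rep] using h

theorem rep_chain {α : Type*} {R : α → α → Prop} {l : List α} (h : l.IsChain R)
    (h2 : ∀ x ∈ l.getLast?, ∀ y ∈ l.head?, R x y) (n : ℕ) : (rep l n).IsChain R := by
  induction n with
  | zero => simp [rep]
  | succ n ih =>
    rw [rep, List.isChain_append]
    exact ⟨h, ih, fun x hx y hy => h2 x hx y (rep_head hy)⟩

theorem isChain_of_forall_split {α : Type*} {R : α → α → Prop} (l : List α)
    (h : ∀ p x y r, l = p ++ x :: y :: r → R x y) : l.IsChain R := by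
  induction l with
  | nil => simp
  | cons a l ih =>
    cases l with
    | nil => simp
    | cons b l =>
      rw [List.isChain_cons_cons]
      exact ⟨h [] a b l rfl, ih fun p x y r e => h (a :: p) x y r (by rw [e]; rfl)⟩

/-- The rotation lemma. -/
theorem rotation_lemma [Nonempty ι] (d : Transversal θ) (N : ℕ) : ∀ l : List (Σ i, F i), l.length = N →
    (∃ i, ∃ c : F i, IsConj (of i c : PushoutI θ) (sprod θ l)) →
    ∃ l', l' ~r l ∧ ∃ i, ∃ c : F i, sprod θ l' = of i c := by
  induction N using Nat.strong_induction_on with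
  | _ N ih =>
    intro l hl hell
    by_cases hm : ∃ a b m, (a :: b :: m) ~r l ∧ Mergeable θ a b
    · obtain ⟨a, b, m, hr, hab⟩ := hm
      obtain ⟨c, hc⟩ := hab.exists
      have hlen : l.length = m.length + 2 := by
        rw [← hr.perm.length_eq]; simp
      have hprod : sprod θ (c :: m) = sprod θ (a :: b :: m) := by
        simp only [sprod_cons, hc, mul_assoc]
      have hconj : IsConj (sprod θ l) (sprod θ (a :: b :: m)) := by
        obtain ⟨n, hn⟩ := hr.symm
        have hsplit : ∃ l1 l2, l = l1 ++ l2 ∧ a :: b :: m = l2 ++ l1 := by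
          refine ⟨l.take (n % l.length), l.drop (n % l.length), by simp, ?_⟩
          rw [← hn, List.rotate_eq_drop_append_take_mod]
        obtain ⟨l1, l2, e1, e2⟩ := hsplit
        rw [e1, e2, sprod_append, sprod_append, isConj_iff]
        exact ⟨(sprod θ l1)⁻¹, by group⟩
      obtain ⟨l', hl', i, x, hx⟩ := ih (m.length + 1) (by omega) (c :: m) (by simp) (by
        obtain ⟨i, x, hx⟩ := hell
        exact ⟨i, x, by rw [hprod]; exact hx.trans hconj⟩)
      obtain ⟨n, hn⟩ := hl'.symm
      have hsplit : ∃ l1 l2, c :: m = l1 ++ l2 ∧ l' = l2 ++ l1 := by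
        refine ⟨(c :: m).take (n % (c :: m).length), (c :: m).drop (n % (c :: m).length),
          by rw [List.take_append_drop], ?_⟩
        rw [← hn, List.rotate_eq_drop_append_take_mod]
      obtain ⟨l1, l2, e1, e2⟩ := hsplit
      cases l1 with
      | nil =>
        refine ⟨a :: b :: m, hr, i, x, ?_⟩
        rw [← hx, ← hprod, e2, e1]; simp
      | cons c' l1 =>
        simp only [List.cons_append, List.cons.injEq] at e1
        obtain ⟨rfl, rfl⟩ := e1
        refine ⟨l2 ++ (a :: b :: l1), ?_, i, x, ?_⟩
        · refine List.IsRotated.trans ?_ hr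
          have : a :: b :: (l1 ++ l2) = (a :: b :: l1) ++ l2 := by simp
          rw [this]
          exact List.isRotated_append
        · rw [← hx, e2]
          simp only [sprod_append, sprod_cons, hc, mul_assoc]
    · push Not at hm
      rcases l with _ | ⟨p, l⟩
      · obtain ⟨i⟩ := ‹Nonempty ι›
        exact ⟨[], List.IsRotated.refl _, i, 1, by simp [sprod]⟩
      rcases l with _ | ⟨q, l⟩
      · exact ⟨[p], List.IsRotated.refl _, p.1, p.2, by simp [sprod]⟩
      exfalso
      set L := p :: q :: l with hL
      have hch : L.IsChain (fun p q => ¬ Mergeable θ p q) := by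
        apply isChain_of_forall_split
        intro u x y r e
        apply hm x y (r ++ u)
        rw [e]
        have : x :: y :: (r ++ u) = (x :: y :: r) ++ u := by simp
        rw [this]
        exact List.isRotated_append
      have hcyc : ∀ x ∈ L.getLast?, ∀ y ∈ L.head?, ¬ Mergeable θ x y := by
        intro x hx y hy
        simp only [hL, List.head?_cons, Option.mem_def, Option.some.injEq] at hy
        subst hy
        have hx' : x ∈ (q :: l).getLast? := by simpa [hL] using hx
        obtain ⟨hne, hr⟩ := List.mem_getLast?_eq_getLast hx'
        have he := List.dropLast_append_getLast hne
        apply hm x p ((q :: l).dropLast)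
        rw [hL]
        nth_rewrite 2 [← he]
        rw [← hr]
        have h1 : x :: p :: (q :: l).dropLast = [x] ++ (p :: (q :: l).dropLast) := by simp
        have h2 : p :: ((q :: l).dropLast ++ [x]) = (p :: (q :: l).dropLast) ++ [x] := by simp
        rw [h1, h2]
        exact List.isRotated_append
      have hA : ∀ x ∈ L, x.2 ∉ (θ x.1).range := by
        intro x hx hx'
        obtain ⟨u, r, e⟩ := List.append_of_mem hx
        have hrot : (x :: r) ++ u ~r L := by rw [e]; exact List.isRotated_append
        have hlen : ((x :: r) ++ u).length = l.length + 2 := by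
          rw [hrot.perm.length_eq]; simp [hL]
        cases hru : r ++ u with
        | nil => simp [hru] at hlen
        | cons y m =>
          rw [List.cons_append, hru] at hrot
          exact hm x y m hrot (Or.inr (Or.inl hx'))
      obtain ⟨i, c, hc⟩ := hell
      obtain ⟨g, hg⟩ := isConj_iff.1 hc
      obtain ⟨lg, hlg⟩ := exists_sprod (θ := θ) g
      obtain ⟨lg', hlg'⟩ := exists_sprod (θ := θ) g⁻¹
      set n := lg.length + 1 + lg'.length + 1 with hn
      have e1 : nlen d (sprod θ (rep L n)) = n * L.length := by
        rw [nlen_reduced d, rep_length]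
        · intro p hp; exact hA p (mem_rep hp)
        · refine (rep_chain hch hcyc n).imp ?_
          intro a b hab h
          exact hab (Or.inl h)
      have e2 : sprod θ (rep L n) = sprod θ (lg ++ [⟨i, c ^ n⟩] ++ lg') := by
        rw [sprod_rep, ← hg, conj_pow, sprod_append, sprod_append, hlg, hlg']
        simp [sprod]
      have e3 := nlen_sprod_le d (lg ++ [⟨i, c ^ n⟩] ++ lg')
      rw [← e2, e1] at e3
      simp only [List.length_append, List.length_singleton, hL, List.length_cons, List.length_nil] at e3
      have e4 := Nat.le_mul_of_pos_right n (show 0 < l.length + 1 + 1 by omega)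
      omega

end Normal

/-! ### Assembly -/

section Assembly

/-- exponentially bounded -/
def EB (M : ℝ) (f : ℕ → ℝ) : Prop :=
  ∃ C ρ : ℝ, 0 < C ∧ 0 < ρ ∧ ρ < 1 ∧ ∀ n : ℕ, f n ≤ C * ρ ^ n * M ^ n

theorem EB.mono {M : ℝ} {f g : ℕ → ℝ} (h : EB M f) (hgf : ∀ n, g n ≤ f n) : EB M g := by
  obtain ⟨C, ρ, h1, h2, h3, h4⟩ := h
  exact ⟨C, ρ, h1, h2, h3, fun n => (hgf n).trans (h4 n)⟩

theorem EB.add {M : ℝ} (hM : 0 ≤ M) {f g : ℕ → ℝ} (hf : EB M f) (hg : EB M g) :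
    EB M (fun n => f n + g n) := by
  obtain ⟨C, ρ, h1, h2, h3, h4⟩ := hf
  obtain ⟨C', ρ', h1', h2', h3', h4'⟩ := hg
  refine ⟨C + C', max ρ ρ', by positivity, lt_max_of_lt_left h2, max_lt h3 h3', fun n => ?_⟩
  have e1 : ρ ^ n ≤ (max ρ ρ') ^ n := pow_le_pow_left₀ h2.le (le_max_left _ _) n
  have e2 : ρ' ^ n ≤ (max ρ ρ') ^ n := pow_le_pow_left₀ h2'.le (le_max_right _ _) n
  calc f n + g n ≤ C * ρ ^ n * M ^ n + C' * ρ' ^ n * M ^ n := add_le_add (h4 n) (h4' n)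
    _ ≤ C * (max ρ ρ') ^ n * M ^ n + C' * (max ρ ρ') ^ n * M ^ n := by gcongr
    _ = _ := by ring

theorem EB.zero {M : ℝ} (hM : 0 ≤ M) : EB M (fun _ => 0) :=
  ⟨1, 1/2, by norm_num, by norm_num, by norm_num, fun n => by positivity⟩

theorem EB.sum {M : ℝ} (hM : 0 ≤ M) {κ : Type*} (s : Finset κ) (f : κ → ℕ → ℝ)
    (hf : ∀ k ∈ s, EB M (f k)) : EB M (fun n => ∑ k ∈ s, f k n) := by
  classical
  induction s using Finset.induction_on with
  | empty => simpa using EB.zero hM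
  | insert k s hk ih =>
    simp only [Finset.sum_insert hk]
    exact (hf k (by simp)).add hM (ih fun j hj => hf j (by simp [hj]))

theorem EB.mul_succ {M : ℝ} (hM : 0 ≤ M) {f : ℕ → ℝ} (hf : EB M f) :
    EB M (fun n => (n + 1 : ℝ) * f n) := by
  obtain ⟨C, ρ, h1, h2, h3, h4⟩ := hf
  set δ : ℝ := (1 - ρ) / (2 * ρ) with hδ
  have hδpos : 0 < δ := by rw [hδ]; apply div_pos <;> linarith
  have hρ' : ρ * (1 + δ) = (1 + ρ) / 2 := by rw [hδ]; field_simp; ring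
  refine ⟨C * (1 + 1 / δ), (1 + ρ) / 2, by positivity, by linarith, by linarith, fun n => ?_⟩
  have hb : 1 + n * δ ≤ (1 + δ) ^ n := one_add_mul_le_pow (by linarith) n
  have hn : (n + 1 : ℝ) ≤ (1 + 1 / δ) * (1 + δ) ^ n := by
    calc (n + 1 : ℝ) ≤ (1 + 1 / δ) * (1 + n * δ) := by
          have : (1 + 1 / δ) * (1 + n * δ) = n + 1 + n * δ + 1 / δ := by field_simp; ring
          rw [this]
          have : 0 ≤ n * δ + 1 / δ := by positivity
          linarith
      _ ≤ _ := by gcongr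
  calc (n + 1 : ℝ) * f n ≤ (n + 1 : ℝ) * (C * ρ ^ n * M ^ n) := by gcongr; exact h4 n
    _ ≤ ((1 + 1 / δ) * (1 + δ) ^ n) * (C * ρ ^ n * M ^ n) := by gcongr
    _ = C * (1 + 1 / δ) * (ρ * (1 + δ)) ^ n * M ^ n := by rw [mul_pow]; ring
    _ = _ := by rw [hρ']

open Monoid.PushoutI Monoid.PushoutI.NormalWord

variable {F : Bool → Type*} {B : Type*} [∀ i, Group (F i)] [Group B]
  {θ : ∀ i, B →* F i} [∀ i, DecidableEq (F i)]

/-- Image of `Start` in a coset space. -/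
def StartQ (d : Transversal θ) (i j : Bool) :
    Set (PushoutI θ ⧸ (of (φ := θ) j).range) := {v | ∃ g ∈ Start d i, (g : PushoutI θ ⧸ _) = v}

theorem mk_mem_StartQ (d : Transversal θ) {i j : Bool} (hij : i ≠ j) (g : PushoutI θ) :
    (g : PushoutI θ ⧸ (of (φ := θ) j).range) ∈ StartQ d i j ↔ g ∈ Start d i := by
  constructor
  · rintro ⟨x, hx, hxg⟩
    obtain ⟨y, hy⟩ := QuotientGroup.eq.1 hxg
    have : g = x * of j y := by rw [hy]; group
    rw [this, Start_right_mul d hij]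
    exact hx
  · intro h; exact ⟨g, h, rfl⟩

theorem factor_bound (d : Transversal θ) (a : Fin 3 → F true) (ha0 : a 0 = 1)
    (ha : ∀ i j, i ≠ j → (a i)⁻¹ * a j ∉ (θ true).range) (k : F false)
    (hk : k ∉ (θ false).range) {α : Type*} [Fintype α] [Nonempty α] (η : α → PushoutI θ)
    (hgen : Submonoid.closure (Set.range η) = ⊤) (j : Bool) (q : PushoutI θ) :
    EB (Fintype.card α) (fun n =>
      (Nat.card {u : Fin n → α // q⁻¹ * evT η u * q ∈ (of (φ := θ) j).range} : ℝ)) := by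
  have key : ∀ n (u : Fin n → α), (evT η u • (q : PushoutI θ ⧸ (of (φ := θ) j).range) = q) ↔
      q⁻¹ * evT η u * q ∈ (of (φ := θ) j).range := by
    intro n u
    rw [eq_comm, MulAction.Quotient.smul_coe, QuotientGroup.eq, smul_eq_mul, mul_assoc]
  have main : ∃ P : Set (PushoutI θ ⧸ (of (φ := θ) j).range),
      (∀ x y, x ≠ y → ∀ v, v ∉ P → (of true (a x) : PushoutI θ)⁻¹ • (of true (a y) : PushoutI θ) • v
        ∈ P) ∧ ∀ v ∈ P, (of false k : PushoutI θ) • v ∉ P := by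
    cases j with
    | false =>
      refine ⟨StartQ d true false, ?_, ?_⟩
      · intro x y hxy v hv
        induction v using QuotientGroup.induction_on with
        | H g =>
          rw [mk_mem_StartQ d (by decide)] at hv
          rw [MulAction.Quotient.smul_coe, MulAction.Quotient.smul_coe,
            mk_mem_StartQ d (by decide), smul_eq_mul, smul_eq_mul, ← mul_assoc, ← map_inv,
            ← map_mul]
          exact mul_mem_Start d _ (ha x y hxy) hv
      · intro v hv
        induction v using QuotientGroup.induction_on with
        | H g =>
          rw [mk_mem_StartQ d (by decide)] at hv
          rw [MulAction.Quotient.smul_coe,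
            mk_mem_StartQ d (by decide), smul_eq_mul]
          exact Start_disj d (by decide) (mul_mem_Start d k hk (Start_disj d (by decide) hv))
    | true =>
      refine ⟨(StartQ d false true)ᶜ, ?_, ?_⟩
      · intro x y hxy v hv
        induction v using QuotientGroup.induction_on with
        | H g =>
          rw [Set.notMem_compl_iff, mk_mem_StartQ d (by decide)] at hv
          rw [Set.mem_compl_iff, MulAction.Quotient.smul_coe, MulAction.Quotient.smul_coe,
            mk_mem_StartQ d (by decide), smul_eq_mul, smul_eq_mul, ← mul_assoc, ← map_inv,
            ← map_mul]
          exact Start_disj d (by decide)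
            (mul_mem_Start d _ (ha x y hxy) (Start_disj d (by decide) hv))
      · intro v hv
        induction v using QuotientGroup.induction_on with
        | H g =>
          rw [Set.mem_compl_iff, mk_mem_StartQ d (by decide)] at hv
          rw [Set.notMem_compl_iff, MulAction.Quotient.smul_coe,
            mk_mem_StartQ d (by decide), smul_eq_mul]
          exact mul_mem_Start d k hk hv
  obtain ⟨P, hP1, hP2⟩ := main
  obtain ⟨C, ρ, h1, h2, h3, h4⟩ := pingpong η hgen P (of false k) (fun x => of true (a x)) hP1
    (by simp [ha0]) hP2 (q : PushoutI θ ⧸ (of (φ := θ) j).range)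
  refine ⟨C, ρ, h1, h2, h3, fun n => ?_⟩
  have := h4 n
  simp only [key] at this
  exact this

theorem flatMap_split {α : Type*} (η : α → PushoutI θ) (ℓ : α → List (Σ i, F i))
    (hℓ : ∀ a, sprod θ (ℓ a) = η a) (Q : Set (PushoutI θ)) (h1 : 1 ∈ Q)
    (hQ : ∀ a p, p <+: ℓ a → sprod θ p ∈ Q) (w : List α) :
    ∀ l1 l2, l1 ++ l2 = w.flatMap ℓ → ∃ u v, w = u ++ v ∧ ∃ q ∈ Q,
      sprod θ l1 = evalWord η u * q := by
  induction w with
  | nil =>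
    intro l1 l2 h
    simp only [List.flatMap_nil, List.append_eq_nil_iff] at h
    exact ⟨[], [], rfl, 1, h1, by simp [h.1, sprod, evalWord]⟩
  | cons a w ih =>
    intro l1 l2 h
    rw [List.flatMap_cons, List.append_eq_append_iff] at h
    rcases h with ⟨m, hm, _⟩ | ⟨m, hm, hm'⟩
    · exact ⟨[], a :: w, rfl, sprod θ l1, hQ a l1 ⟨m, hm.symm⟩, by simp [evalWord]⟩
    · obtain ⟨u, v, huv, q, hq, he⟩ := ih m l2 hm'.symm
      refine ⟨a :: u, v, by rw [huv]; rfl, q, hq, ?_⟩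
      rw [hm, sprod_append, he, hℓ]
      simp [evalWord, mul_assoc]

theorem sprod_flatMap {α : Type*} (η : α → PushoutI θ) (ℓ : α → List (Σ i, F i))
    (hℓ : ∀ a, sprod θ (ℓ a) = η a) (w : List α) :
    sprod θ (w.flatMap ℓ) = evalWord η w := by
  induction w with
  | nil => simp [sprod, evalWord]
  | cons a w ih =>
    rw [List.flatMap_cons, sprod_append, hℓ, ih]
    simp [evalWord]

/-- Elliptic words have a rotation in one of finitely many vertex stabilisers. -/
theorem elliptic_rotation (d : Transversal θ) {α : Type*} [Fintype α] (η : α → PushoutI θ) :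
    ∃ Q : Finset (PushoutI θ), ∀ w : List α,
      (∃ i, ∃ c : F i, IsConj (of i c : PushoutI θ) (evalWord η w)) →
      ∃ w', w' ~r w ∧ ∃ q ∈ Q, ∃ j, q⁻¹ * evalWord η w' * q ∈ (of (φ := θ) j).range := by
  classical
  choose ℓ hℓ using fun a => exists_sprod (η a)
  let Q : Finset (PushoutI θ) :=
    insert 1 (Finset.univ.biUnion fun a => ((ℓ a).inits.map (sprod θ)).toFinset)
  refine ⟨Q, fun w hw => ?_⟩
  rw [← sprod_flatMap η ℓ hℓ] at hw
  obtain ⟨l', hl', i, c, hc⟩ := rotation_lemma d _ _ rfl hw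
  obtain ⟨n, hn⟩ := hl'.symm
  obtain ⟨l1, l2, e1, e2⟩ : ∃ l1 l2, l1 ++ l2 = w.flatMap ℓ ∧ l' = l2 ++ l1 := by
    refine ⟨_, _, List.take_append_drop (n % (w.flatMap ℓ).length) _, ?_⟩
    rw [← hn, List.rotate_eq_drop_append_take_mod]
  obtain ⟨u, v, huv, q, hq, he⟩ := flatMap_split η ℓ hℓ (Q : Set (PushoutI θ)) (by simp [Q])
    (by
      intro a p hp
      simp only [Q, Finset.coe_insert, Set.mem_insert_iff]
      right
      simp only [Finset.mem_coe, Finset.mem_biUnion, Finset.mem_univ, true_and, List.mem_toFinset,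
        List.mem_map, List.mem_inits]
      exact ⟨a, p, hp, rfl⟩) w l1 l2 e1
  refine ⟨v ++ u, ?_, q, hq, i, c, ?_⟩
  · rw [huv]; exact List.isRotated_append
  · have e3 : sprod θ l1 * sprod θ l2 = evalWord η u * evalWord η v := by
      rw [← sprod_append, e1, sprod_flatMap η ℓ hℓ, huv, evalWord_append]
    rw [← hc, e2, sprod_append, evalWord_append]
    have e4 : sprod θ l2 = (sprod θ l1)⁻¹ * (evalWord η u * evalWord η v) := by
      rw [← e3]; group
    rw [e4, he]; group

theorem ncard_ofFn_le {α : Type*} [Fintype α] (p : List α → Prop) (n : ℕ) :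
    {w : List α | p w ∧ w.length = n}.ncard ≤ Nat.card {u : Fin n → α // p (List.ofFn u)} := by
  have : {w : List α | p w ∧ w.length = n} =
      (fun u : Fin n → α => List.ofFn u) '' {u | p (List.ofFn u)} := by
    ext w
    simp only [Set.mem_ofPred_eq, Set.mem_image]
    constructor
    · rintro ⟨h, rfl⟩
      exact ⟨w.get, by simpa using h, by simp⟩
    · rintro ⟨u, hu, rfl⟩
      exact ⟨hu, by simp⟩
  rw [this]
  exact Set.ncard_image_le (Set.toFinite _)

theorem elliptic_EB (d : Transversal θ) (a : Fin 3 → F true) (ha0 : a 0 = 1)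
    (ha : ∀ i j, i ≠ j → (a i)⁻¹ * a j ∉ (θ true).range) (k : F false)
    (hk : k ∉ (θ false).range) {α : Type*} [Fintype α] (η : α → PushoutI θ)
    (hgen : Submonoid.closure (Set.range η) = ⊤) :
    EB (Fintype.card α) (fun n => (wordCount {w : List α |
      ∃ i, ∃ c : F i, IsConj (of i c : PushoutI θ) (evalWord η w)} n : ℝ)) := by
  have hne : Nonempty α := by
    by_contra h
    rw [not_nonempty_iff] at h
    rw [Set.range_eq_empty, Submonoid.closure_empty] at hgen
    have h1 : (of false k : PushoutI θ) * 1 ∈ (⊤ : Submonoid (PushoutI θ)) := trivial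
    rw [← hgen, Submonoid.mem_bot] at h1
    have h2 := mul_mem_Start d k hk (one_notMem_Start d false)
    rw [h1] at h2
    exact one_notMem_Start d false h2
  obtain ⟨Q, hQ⟩ := elliptic_rotation d η
  have hM : (0 : ℝ) ≤ (Fintype.card α : ℝ) := by positivity
  refine (EB.mul_succ hM (EB.sum hM Q (fun q n => ∑ j ∈ (Finset.univ : Finset Bool),
    (Nat.card {u : Fin n → α // q⁻¹ * evT η u * q ∈ (of (φ := θ) j).range} : ℝ))
    (fun q _ => EB.sum hM _ _ (fun j _ => factor_bound d a ha0 ha k hk η hgen j q)))).mono ?_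
  intro n
  set S : PushoutI θ → Bool → Set (List α) := fun q j =>
    {w | q⁻¹ * evalWord η w * q ∈ (of (φ := θ) j).range ∧ w.length = n} with hS
  have hfin : ∀ T : Set (List α), (∀ w ∈ T, w.length = n) → T.Finite := fun T hT =>
    (List.finite_length_eq α n).subset hT
  have hsub : {w : List α | w ∈ {w : List α |
      ∃ i, ∃ c : F i, IsConj (of i c : PushoutI θ) (evalWord η w)} ∧ w.length = n} ⊆
      ⋃ m ∈ Finset.range (n + 1), (fun w => w.rotate m) '' (⋃ q ∈ Q, ⋃ j ∈ Finset.univ, S q j) := by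
    rintro w ⟨hw, hwn⟩
    obtain ⟨w', hw', q, hq, j, hj⟩ := hQ w hw
    have hlen : w'.length = n := by rw [hw'.perm.length_eq, hwn]
    obtain ⟨m, hm, hm'⟩ := List.isRotated_iff_mod.1 hw'
    simp only [Set.mem_iUnion]
    refine ⟨m, by simp; omega, w', ?_, hm'⟩
    simp only [Set.mem_iUnion]
    exact ⟨q, hq, j, Finset.mem_univ _, hj, hlen⟩
  have hfinU : (⋃ q ∈ Q, ⋃ j ∈ (Finset.univ : Finset Bool), S q j).Finite := by
    apply hfin
    intro w hw
    simp only [Set.mem_iUnion] at hw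
    obtain ⟨q, _, j, _, h⟩ := hw
    exact h.2
  have hN : wordCount {w : List α |
      ∃ i, ∃ c : F i, IsConj (of i c : PushoutI θ) (evalWord η w)} n ≤
      (n + 1) * ∑ q ∈ Q, ∑ j ∈ (Finset.univ : Finset Bool),
        Nat.card {u : Fin n → α // q⁻¹ * evT η u * q ∈ (of (φ := θ) j).range} := by
    calc _ ≤ (⋃ m ∈ Finset.range (n + 1), (fun w : List α => w.rotate m) ''
          (⋃ q ∈ Q, ⋃ j ∈ (Finset.univ : Finset Bool), S q j)).ncard :=
          Set.ncard_le_ncard hsub ((Finset.range (n+1)).finite_toSet.biUnion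
            fun m _ => hfinU.image _)
      _ ≤ ∑ m ∈ Finset.range (n + 1), ((fun w : List α => w.rotate m) ''
          (⋃ q ∈ Q, ⋃ j ∈ (Finset.univ : Finset Bool), S q j)).ncard :=
          Finset.set_ncard_biUnion_le _ _
      _ ≤ ∑ m ∈ Finset.range (n + 1),
          (⋃ q ∈ Q, ⋃ j ∈ (Finset.univ : Finset Bool), S q j).ncard :=
          Finset.sum_le_sum fun m _ => Set.ncard_image_le hfinU
      _ = (n + 1) * (⋃ q ∈ Q, ⋃ j ∈ (Finset.univ : Finset Bool), S q j).ncard := by simp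
      _ ≤ _ := by
        gcongr
        refine (Finset.set_ncard_biUnion_le _ _).trans (Finset.sum_le_sum fun q _ => ?_)
        refine (Finset.set_ncard_biUnion_le _ _).trans (Finset.sum_le_sum fun j _ => ?_)
        exact ncard_ofFn_le (fun w => q⁻¹ * evalWord η w * q ∈ (of (φ := θ) j).range) n
  exact_mod_cast hN

theorem exists_not_mem {N : Type*} [Group N] (S : Subgroup N) (h : 2 ≤ Cardinal.mk (N ⧸ S)) :
    ∃ k : N, k ∉ S := by
  rw [Cardinal.two_le_iff' ((1 : N) : N ⧸ S)] at h
  obtain ⟨y, hy⟩ := h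
  induction y using QuotientGroup.induction_on with
  | H k =>
    refine ⟨k, fun hk => hy ?_⟩
    exact (QuotientGroup.eq.2 (by simpa using hk)).symm

theorem exists_three {N : Type*} [Group N] (S : Subgroup N) (h : 3 ≤ Cardinal.mk (N ⧸ S)) :
    ∃ a : Fin 3 → N, a 0 = 1 ∧ ∀ i j, i ≠ j → (a i)⁻¹ * a j ∉ S := by
  obtain ⟨y, hy1, -⟩ := Cardinal.exists_ne_ne_of_three_le h ((1 : N) : N ⧸ S) ((1 : N) : N ⧸ S)
  obtain ⟨z, hz1, hzy⟩ := Cardinal.exists_ne_ne_of_three_le h ((1 : N) : N ⧸ S) y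
  induction y using QuotientGroup.induction_on with
  | H y =>
  induction z using QuotientGroup.induction_on with
  | H z =>
    refine ⟨![1, y, z], rfl, ?_⟩
    intro i j hij hmem
    have hq := QuotientGroup.eq.2 hmem
    fin_cases i <;> fin_cases j <;> simp at hij hq <;>
      first
        | exact hy1 hq
        | exact hy1 hq.symm
        | exact hz1 hq
        | exact hz1 hq.symm
        | exact hzy hq
        | exact hzy hq.symm

end Assembly

/-- For `G = H ∗_A K` with `[H:A] ≥ 3` and `[K:A] ≥ 2`, and any map
`η : Σ → G` from a finite set whose image generates `G` as a monoid, the set of words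
representing elliptic elements is strongly negligible; equivalently, the set of words
representing hyperbolic elements is strongly generic. -/
theorem stmt_2 {A : Type*} {H K : Type u} [Group A] [Group H] [Group K]
    (φ : A →* H) (ψ : A →* K) (hφ : Function.Injective φ) (hψ : Function.Injective ψ)
    (hH3 : 3 ≤ Cardinal.mk (H ⧸ φ.range))
    (hK2 : 2 ≤ Cardinal.mk (K ⧸ ψ.range))
    {α : Type*} [Fintype α] (η : α → AmalgProd φ ψ)
    (hgen : Submonoid.closure (Set.range η) = ⊤) :
    StronglyNegligible {w : List α |
        IsElliptic (((amalgH φ ψ).range : Set (AmalgProd φ ψ)) ∪ (amalgK φ ψ).range)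
          (evalWord η w)} ∧
    StronglyGeneric {w : List α |
        ¬ IsElliptic (((amalgH φ ψ).range : Set (AmalgProd φ ψ)) ∪ (amalgK φ ψ).range)
          (evalWord η w)} := by

  classical
  have hinj : ∀ b, Function.Injective (amalgMaps φ ψ b) := by
    intro b
    cases b
    · exact hψ
    · exact hφ
  obtain ⟨d⟩ := Monoid.PushoutI.NormalWord.transversal_nonempty (amalgMaps φ ψ) hinj
  obtain ⟨a, ha0, ha⟩ := exists_three φ.range hH3
  obtain ⟨k, hk⟩ := exists_not_mem ψ.range hK2
  have hset : {w : List α |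
        IsElliptic (((amalgH φ ψ).range : Set (AmalgProd φ ψ)) ∪ (amalgK φ ψ).range)
          (evalWord η w)} = {w : List α | ∃ i, ∃ c : AmalgFam H K i,
            IsConj (Monoid.PushoutI.of i c : AmalgProd φ ψ) (evalWord η w)} := by
    ext w
    constructor
    · rintro ⟨h, (⟨c, rfl⟩ | ⟨c, rfl⟩), hc⟩
      · exact ⟨true, c, hc⟩
      · exact ⟨false, c, hc⟩
    · rintro ⟨i, c, hc⟩
      cases i
      · exact ⟨_, Or.inr ⟨c, rfl⟩, hc⟩
      · exact ⟨_, Or.inl ⟨c, rfl⟩, hc⟩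
  have main : StronglyNegligible {w : List α |
        IsElliptic (((amalgH φ ψ).range : Set (AmalgProd φ ψ)) ∪ (amalgK φ ψ).range)
          (evalWord η w)} := by
    rw [hset]
    exact elliptic_EB (θ := amalgMaps φ ψ) d a ha0 ha k hk η hgen
  refine ⟨main, ?_⟩
  unfold StronglyGeneric
  convert! main using 1
  ext w
  simp only [Set.mem_compl_iff, Set.mem_ofPred_eq, not_not]
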